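/- arXiv:math/0601317 — 2 statements merged into one kernel-verified Lean document; each statement's English description precedes it below -/
import Mathlib

section
/- Let (W_n,S_n) be of type B_n with S_n = {t,s₁,…,s_{n−1}} and (W_{n−1},S_{n−1}) the standard parabolic of type B_{n−1} generated by S_{n−1} = {t,s₁,…,s_{n−2}}. Then the restriction morphism Res_{S_{n−1}} : Σ(W_n) → Σ(W_{n−1}) is surjective. -/
open MonoidAlgebra

variable {B W : Type*} [DecidableEq B] [Fintype B] [Group W] [Fintype W] [DecidableEq W]

/-- `x_I`: the sum, in the group algebra `ℚW`, of the minimal length coset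
representatives of the standard parabolic subgroup `W_I` in `W`, i.e. the sum of the
`w ∈ W` such that `ws > w` for all `s ∈ I`. -/
noncomputable def descentBasis {M : CoxeterMatrix B} (cs : CoxeterSystem M W)
    (I : Finset B) : MonoidAlgebra ℚ W :=
  ∑ w : W, if ∀ i ∈ I, cs.length w < cs.length (w * cs.simple i)
    then MonoidAlgebra.single w (1 : ℚ) else 0

/-- `A` is the Solomon descent algebra `Σ(W)` of `(W,S)`: a subalgebra of the group
algebra `ℚW` whose underlying set is the span of the elements `x_I`, `I ⊆ S`.
(By Solomon's theorem this span is indeed closed under multiplication.) -/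
def IsDescentAlgebra {M : CoxeterMatrix B} (cs : CoxeterSystem M W)
    (A : Subalgebra ℚ (MonoidAlgebra ℚ W)) : Prop :=
  (A : Set (MonoidAlgebra ℚ W)) = Submodule.span ℚ (Set.range (descentBasis cs))

/-- The standard parabolic subgroup `W_I` generated by the simple reflections in `I`. -/
def parabolic {M : CoxeterMatrix B} (cs : CoxeterSystem M W) (I : Finset B) : Subgroup W :=
  Subgroup.closure (cs.simple '' I)

open scoped Classical in
/-- `x^K_I`: the sum of the elements `w` of the standard parabolic subgroup `W_K` such
that `ws > w` for all `s ∈ I`; for `I ⊆ K` these are the minimal length coset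
representatives of `W_I` in `W_K`, and this is the basis element of the descent
algebra `Σ(W_K)` (viewed inside `ℚW`). -/
noncomputable def parDescentBasis {M : CoxeterMatrix B} (cs : CoxeterSystem M W)
    (K I : Finset B) : MonoidAlgebra ℚ W :=
  ∑ w : W, if w ∈ parabolic cs K ∧ ∀ i ∈ I, cs.length w < cs.length (w * cs.simple i)
    then MonoidAlgebra.single w (1 : ℚ) else 0

/-- `d ∈ X_{KI} = X_K⁻¹ ∩ X_I`. -/
def memXKI {M : CoxeterMatrix B} (cs : CoxeterSystem M W) (K I : Finset B) (d : W) : Prop :=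
  (∀ i ∈ K, cs.length d⁻¹ < cs.length (d⁻¹ * cs.simple i)) ∧
    (∀ i ∈ I, cs.length d < cs.length (d * cs.simple i))

open scoped Classical in
/-- The defining property of the restriction morphism `Res_K : Σ(W) → Σ(W_K)`,
`Res_K(x_I) = Σ_{d ∈ X_{KI}} x^K_{K ∩ dId⁻¹}`, where `R` is a linear extension of it. -/
def IsResK {M : CoxeterMatrix B} (cs : CoxeterSystem M W) (K : Finset B)
    (R : MonoidAlgebra ℚ W →ₗ[ℚ] MonoidAlgebra ℚ W) : Prop :=
  ∀ I : Finset B, R (descentBasis cs I) =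
    ∑ d : W, if memXKI cs K I d
      then parDescentBasis cs K
        (K.filter (fun j => ∃ i ∈ I, cs.simple j = d * cs.simple i * d⁻¹))
      else 0


namespace ResB

section Words

variable {G : Type*} [Group G]

/-- The letters of the longest coset representative: `0,1,…,n,n-1,…,0`. -/
def cIdx (n a : ℕ) : ℕ := if a ≤ n then a else 2 * n - a

/-- The coset representatives `s₀ s₁ ⋯`. -/
def dElt (n : ℕ) (S : ℕ → G) : ℕ → G
  | 0 => 1
  | m + 1 => dElt n S m * S (cIdx n m)

/-- The type B relations. -/
structure Rels (n : ℕ) (S : ℕ → G) : Prop where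
  sq : ∀ a, S a * S a = 1
  comm : ∀ a b, a + 2 ≤ b → b ≤ n → S a * S b = S b * S a
  braid : ∀ a, a + 1 < n → S a * S (a + 1) * S a = S (a + 1) * S a * S (a + 1)
  quad : ∀ a, a + 1 = n → S a * S (a + 1) * S a * S (a + 1) = S (a + 1) * S a * S (a + 1) * S a

variable {n : ℕ} {S : ℕ → G}

lemma tableA (h : Rels n S) (m i : ℕ) (hm : m < i) (hi : i ≤ n) :
    dElt n S m * S i = S i * dElt n S m := by
  induction m with
  | zero => simp [dElt]
  | succ m ih =>
    have hc : cIdx n m = m := by simp [cIdx]; omega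
    rw [dElt, hc, mul_assoc, h.comm m i (by omega) hi, ← mul_assoc, ih (by omega), mul_assoc]

lemma tableB (h : Rels n S) (i k : ℕ) (hm : i + 2 + k + i + 1 ≤ 2 * n) :
    dElt n S (i + 2 + k) * S i = S (i + 1) * dElt n S (i + 2 + k) := by
  induction k with
  | zero =>
    have hc : cIdx n i = i := by simp [cIdx]; omega
    have hc' : cIdx n (i + 1) = i + 1 := by simp [cIdx]; omega
    have hb := h.braid i (by omega)
    have hA := tableA h i (i + 1) (by omega) (by omega)
    calc dElt n S (i + 2) * S i = dElt n S i * (S i * S (i + 1) * S i) := by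
          simp [dElt, hc, hc', mul_assoc]
      _ = (dElt n S i * S (i + 1)) * S i * S (i + 1) := by rw [hb]; simp [mul_assoc]
      _ = _ := by rw [hA]; simp [dElt, hc, hc', mul_assoc]
  | succ k ih =>
    have hc : i + 2 ≤ cIdx n (i + 2 + k) ∧ cIdx n (i + 2 + k) ≤ n := by
      unfold cIdx; split_ifs <;> omega
    rw [← add_assoc, dElt, mul_assoc, ← h.comm i _ hc.1 hc.2, ← mul_assoc, ih (by omega), mul_assoc]

lemma tableC (h : Rels n S) (i k : ℕ) (hi : 1 ≤ i) (hin : i ≤ n) (hk : k + 1 ≤ i) :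
    dElt n S (2 * n + 2 - i + k) * S i = S i * dElt n S (2 * n + 2 - i + k) := by
  induction k with
  | zero =>
    obtain ⟨i, rfl⟩ : ∃ a, i = a + 1 := ⟨i - 1, by omega⟩
    have e : 2 * n + 2 - (i + 1) + 0 = (2 * n - (i + 1)) + 2 := by omega
    have hc : cIdx n (2 * n - (i + 1)) = i + 1 := by unfold cIdx; split_ifs <;> omega
    have hc' : cIdx n (2 * n - (i + 1) + 1) = i := by unfold cIdx; split_ifs <;> omega
    rw [e]
    rcases Nat.lt_or_ge (i + 1) n with hlt | hge
    · have hb := h.braid i hlt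
      have hB := tableB h i (2 * n - (i + 1) - (i + 2)) (by omega)
      rw [show i + 2 + (2 * n - (i + 1) - (i + 2)) = 2 * n - (i + 1) by omega] at hB
      calc dElt n S (2 * n - (i + 1) + 2) * S (i + 1)
          = dElt n S (2 * n - (i + 1)) * (S (i + 1) * S i * S (i + 1)) := by
            simp [dElt, hc, hc', mul_assoc]
        _ = (dElt n S (2 * n - (i + 1)) * S i) * S (i + 1) * S i := by
            rw [← hb]; simp [mul_assoc]
        _ = _ := by rw [hB]; simp [dElt, hc, hc', mul_assoc]
    · have hn : i + 1 = n := by omega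
      have e2 : 2 * n - (i + 1) = i + 1 := by omega
      rw [e2] at hc hc' ⊢
      have hc3 : cIdx n i = i := by simp [cIdx]; omega
      have hq := h.quad i hn
      have hA := tableA h i (i + 1) (by omega) (by omega)
      calc dElt n S (i + 1 + 2) * S (i + 1)
          = dElt n S i * (S i * S (i + 1) * S i * S (i + 1)) := by
            simp only [dElt, hc, hc', hc3, mul_assoc]
        _ = (dElt n S i * S (i + 1)) * S i * S (i + 1) * S i := by
            rw [hq]; simp [mul_assoc]
        _ = _ := by rw [hA]; simp only [dElt, hc, hc', hc3, mul_assoc]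
  | succ k ih =>
    have hc : cIdx n (2 * n + 2 - i + k) + 2 ≤ i := by
      unfold cIdx; split_ifs <;> omega
    rw [← add_assoc, dElt, mul_assoc, h.comm _ i hc hin, ← mul_assoc, ih (by omega), mul_assoc]

/-- The multiplication table of coset representatives. -/
lemma table (h : Rels n S) (m i : ℕ) (hm : m ≤ 2 * n + 1) (hi : i ≤ n) :
    (m ≤ 2 * n ∧ i = cIdx n m) ∨ (∃ m', m = m' + 1 ∧ i = cIdx n m') ∨
    (∃ j, 1 ≤ j ∧ i ≤ j ∧ j ≤ n ∧ dElt n S m * S i = S j * dElt n S m) := by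
  by_cases h1 : m ≤ 2 * n ∧ i = cIdx n m
  · exact Or.inl h1
  by_cases h2 : ∃ m', m = m' + 1 ∧ i = cIdx n m'
  · exact Or.inr (Or.inl h2)
  refine Or.inr (Or.inr ?_)
  have h2' : m = 0 ∨ i ≠ cIdx n (m - 1) := by
    rcases m with _ | m
    · simp
    · right; intro h; exact h2 ⟨m, rfl, by simpa using h⟩
  by_cases ha : m < i
  · exact ⟨i, by omega, le_rfl, hi, tableA h m i ha hi⟩
  by_cases hb : i + 2 ≤ m ∧ m + i + 1 ≤ 2 * n
  · refine ⟨i + 1, by omega, by omega, by omega, ?_⟩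
    have := tableB h i (m - (i + 2)) (by omega)
    rwa [show i + 2 + (m - (i + 2)) = m by omega] at this
  · have hh : 2 * n + 2 ≤ m + i := by
      unfold cIdx at h1 h2'
      split_ifs at h1 h2' <;> omega
    refine ⟨i, by omega, le_rfl, hi, ?_⟩
    have := tableC h i (m + i - (2 * n + 2)) (by omega) hi (by omega)
    rwa [show 2 * n + 2 - i + (m + i - (2 * n + 2)) = m by omega] at this

end Words

section Model

/-- The action of the `k`-th generator on a path with `2n+2` vertices. -/
def act (n : ℕ) (k : ℕ) : ℤ → ℤ := fun x =>
  if x = k then k + 1 else if x = k + 1 then k else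
  if x = 2 * n - k then 2 * n + 1 - k else if x = 2 * n + 1 - k then 2 * n - k else x

/-- The same, in the monoid of endomaps. -/
def actE (n k : ℕ) : Function.End ℤ := act n k

lemma act1 {n k : ℕ} {x : ℤ} (h : x = k) : act n k x = k + 1 := by
  unfold act; split_ifs; omega

lemma act2 {n k : ℕ} {x : ℤ} (h : x = k + 1) : act n k x = k := by
  unfold act; split_ifs <;> omega

lemma act3 {n k : ℕ} {x : ℤ} (hk : k ≤ n) (h : x = 2 * n - k) : act n k x = 2 * n + 1 - k := by
  unfold act; split_ifs <;> omega

lemma act4 {n k : ℕ} {x : ℤ} (hk : k ≤ n) (h : x = 2 * n + 1 - k) : act n k x = 2 * n - k := by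
  unfold act; split_ifs <;> omega

lemma act0 {n k : ℕ} {x : ℤ} (h1 : x ≠ k) (h2 : x ≠ k + 1) (h3 : x ≠ 2 * n - k)
    (h4 : x ≠ 2 * n + 1 - k) : act n k x = x := by
  unfold act; rw [if_neg h1, if_neg h2, if_neg h3, if_neg h4]

lemma act_act (n k : ℕ) (hk : k ≤ n) (x : ℤ) : act n k (act n k x) = x := by
  unfold act; split_ifs <;> omega

lemma act_cases (n k : ℕ) (x : ℤ) : x = k ∨ x = k + 1 ∨ x = 2 * n - k ∨ x = 2 * n + 1 - k ∨
    (x ≠ k ∧ x ≠ k + 1 ∧ x ≠ 2 * n - k ∧ x ≠ 2 * n + 1 - k) := by omega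

lemma act_comm (n i j : ℕ) (h : i + 2 ≤ j) (hk : j ≤ n) (x : ℤ) :
    act n i (act n j x) = act n j (act n i x) := by
  rcases act_cases n i x with h1 | h1 | h1 | h1 | h1 <;>
  rcases act_cases n j x with h2 | h2 | h2 | h2 | h2 <;>
  first
  | omega
  | (simp (disch := omega) only [act1, act2, act3, act4, act0])

lemma act_braid (n i : ℕ) (h : i + 1 < n) (x : ℤ) :
    act n i (act n (i + 1) (act n i x)) = act n (i + 1) (act n i (act n (i + 1) x)) := by
  rcases act_cases n i x with h1 | h1 | h1 | h1 | h1 <;>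
  rcases act_cases n (i + 1) x with h2 | h2 | h2 | h2 | h2 <;>
  first
  | omega
  | (simp (disch := omega) only [act1, act2, act3, act4, act0] <;> omega)

lemma act_quad (n i : ℕ) (h : i + 1 = n) (x : ℤ) :
    act n i (act n (i + 1) (act n i (act n (i + 1) x))) =
      act n (i + 1) (act n i (act n (i + 1) (act n i x))) := by
  rcases act_cases n i x with h1 | h1 | h1 | h1 | h1 <;>
  rcases act_cases n (i + 1) x with h2 | h2 | h2 | h2 | h2 <;>
  first
  | omega
  | (simp (disch := omega) only [act1, act2, act3, act4, act0] <;> omega)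

lemma act_inj (n i j : ℕ) (hi : i ≤ n) (hj : j ≤ n) (h : act n i = act n j) : i = j := by
  by_contra hne
  rcases Nat.lt_or_ge i j with hlt | hge
  · have h1 := congrFun h (i : ℤ)
    rw [act1 rfl, act0 (by omega) (by omega) (by omega) (by omega)] at h1
    omega
  · have h1 := congrFun h (j : ℤ)
    rw [act1 (k := j) rfl, act0 (by omega) (by omega) (by omega) (by omega)] at h1
    omega

end Model



section Cox

variable {V : Type*} [Group V] {n : ℕ}

lemma B_apply (i j : Fin (n + 1)) : CoxeterMatrix.Bₙ (n + 1) i j =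
    if i = j then 1 else (if (i : ℕ) = n + 1 - 1 ∧ (j : ℕ) = n + 1 - 2 ∨
      (j : ℕ) = n + 1 - 1 ∧ (i : ℕ) = n + 1 - 2 then 4
        else (if (j : ℕ) + 1 = i ∨ (i : ℕ) + 1 = j then 3 else 2)) := by
  rfl

lemma act_liftable : (CoxeterMatrix.Bₙ (n + 1)).IsLiftable
    (fun i : Fin (n + 1) => actE n i) := by
  intro i j
  have hi : (i : ℕ) ≤ n := by omega
  have hj : (j : ℕ) ≤ n := by omega
  have sqi := act_act n i hi
  have sqj := act_act n j hj
  rw [B_apply]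
  funext x
  split_ifs with h1 h2 h3
  · subst h1
    rw [pow_one]
    exact sqi x
  · change act n i (act n j (act n i (act n j (act n i (act n j (act n i (act n j x))))))) = x
    rcases h2 with ⟨h, h'⟩ | ⟨h, h'⟩
    · have hq := act_quad n j (by have := Fin.val_ne_of_ne h1; omega)
      have e : (i : ℕ) = j + 1 := by have := Fin.val_ne_of_ne h1; omega
      rw [← e] at hq
      rw [← hq (act n i (act n j (act n i (act n j x)))), sqi, sqj, sqi, sqj]
    · have hq := act_quad n i (by have := Fin.val_ne_of_ne h1; omega)
      have e : (j : ℕ) = i + 1 := by have := Fin.val_ne_of_ne h1; omega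
      rw [← e] at hq
      rw [hq (act n i (act n j (act n i (act n j x)))), sqi, sqj, sqi, sqj]
  · change act n i (act n j (act n i (act n j (act n i (act n j x))))) = x
    rcases h3 with h | h
    · have hq := act_braid n j (by omega)
      rw [h] at hq
      rw [← hq (act n j (act n i (act n j x))), sqj, sqi, sqj]
    · have hq := act_braid n i (by omega)
      rw [h] at hq
      rw [hq (act n j (act n i (act n j x))), sqj, sqi, sqj]
  · change act n i (act n j (act n i (act n j x))) = x
    have := Fin.val_ne_of_ne h1
    have hc : ∀ y, act n i (act n j y) = act n j (act n i y) := by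
      intro y
      rcases Nat.lt_or_ge i j with h | h
      · exact act_comm n i j (by omega) hj y
      · exact (act_comm n j i (by omega) hi y).symm
    rw [hc, sqi, sqj]

variable (cs : CoxeterSystem (CoxeterMatrix.Bₙ (n + 1)) V)

/-- The permutation representation. -/
noncomputable def rep : V →* Function.End ℤ := cs.lift ⟨_, act_liftable⟩

lemma rep_simple (i : Fin (n + 1)) : rep cs (cs.simple i) = actE n i :=
  cs.lift_apply_simple act_liftable i

lemma rep_inj (v : V) (x y : ℤ) (h : rep cs v x = rep cs v y) : x = y := by
  have h1 : ∀ z, rep cs v⁻¹ (rep cs v z) = z := by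
    intro z
    change (rep cs v⁻¹ * rep cs v) z = z
    rw [← map_mul, inv_mul_cancel, map_one]
    rfl
  rw [← h1 x, h, h1 y]

lemma simple_inj (i j : Fin (n + 1)) (h : cs.simple i = cs.simple j) : i = j := by
  apply Fin.ext
  apply act_inj n i j (by omega) (by omega)
  change actE n i = actE n j
  rw [← rep_simple cs, h, rep_simple cs]

/-- The simple reflections indexed by natural numbers. -/
noncomputable def sN (k : ℕ) : V := if h : k < n + 1 then cs.simple ⟨k, h⟩ else 1

lemma sN_val (i : Fin (n + 1)) : sN cs i = cs.simple i := by
  simp only [sN, i.isLt, dif_pos]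

lemma sN_of_le (k : ℕ) (h : k ≤ n) : sN cs k = cs.simple ⟨k, by omega⟩ := by
  simp [sN, Nat.lt_succ_of_le h]

lemma rels : Rels n (sN cs) := by
  have sq : ∀ a, sN cs a * sN cs a = 1 := by
    intro a; unfold sN; split_ifs <;> simp
  have inv : ∀ a, (sN cs a)⁻¹ = sN cs a := fun a => inv_eq_of_mul_eq_one_left (sq a)
  refine ⟨sq, ?_, ?_, ?_⟩
  · intro a b hab hb
    have h := cs.simple_mul_simple_pow ⟨a, by omega⟩ ⟨b, by omega⟩
    rw [B_apply, if_neg (by simp; omega), if_neg (by simp; omega), if_neg (by simp; omega),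
      ← sN_val, ← sN_val] at h
    have h2 := eq_inv_of_mul_eq_one_left ((pow_two _).symm.trans h)
    simpa [inv] using h2
  · intro a ha
    have h := cs.simple_mul_simple_pow ⟨a, by omega⟩ ⟨a + 1, by omega⟩
    rw [B_apply, if_neg (by simp), if_neg (by simp; omega), if_pos (by simp),
      ← sN_val, ← sN_val] at h
    have h2 : (sN cs a * sN cs (a + 1) * sN cs a) * (sN cs (a + 1) * sN cs a * sN cs (a + 1)) = 1 := by
      rw [← h]; simp [pow_succ, mul_assoc]
    have h3 := eq_inv_of_mul_eq_one_left h2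
    simpa [inv, mul_assoc] using h3
  · intro a ha
    have h := cs.simple_mul_simple_pow ⟨a, by omega⟩ ⟨a + 1, by omega⟩
    rw [B_apply, if_neg (by simp), if_pos (by simp; omega),
      ← sN_val, ← sN_val] at h
    have h2 : (sN cs a * sN cs (a + 1) * sN cs a * sN cs (a + 1)) *
        (sN cs a * sN cs (a + 1) * sN cs a * sN cs (a + 1)) = 1 := by
      rw [← h]; simp [pow_succ, mul_assoc]
    have h3 := eq_inv_of_mul_eq_one_left h2
    simpa [inv, mul_assoc] using h3

lemma cIdx_le (a : ℕ) : cIdx n a ≤ n := by unfold cIdx; split_ifs <;> omega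

lemma length_dElt (m : ℕ) : cs.length (dElt n (sN cs) m) ≤ m := by
  induction m with
  | zero => simp [dElt]
  | succ m ih =>
    rw [dElt, sN_of_le cs _ (cIdx_le m)]
    have := cs.length_mul_le (dElt n (sN cs) m) (cs.simple ⟨cIdx n m, by have := @cIdx_le n m; omega⟩)
    rw [cs.length_simple] at this
    omega

lemma rep_dElt (m : ℕ) (hm : m ≤ 2 * n + 1) : rep cs (dElt n (sN cs) m) (m : ℤ) = 0 := by
  induction m with
  | zero =>
    rw [dElt, map_one]
    rfl
  | succ m ih =>
    rw [dElt, sN_of_le cs _ (cIdx_le m), map_mul, rep_simple]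
    change rep cs (dElt n (sN cs) m) (act n (cIdx n m) ((m + 1 : ℕ) : ℤ)) = 0
    have : act n (cIdx n m) ((m + 1 : ℕ) : ℤ) = m := by
      unfold cIdx
      split_ifs with h
      · rw [act2 (by push_cast; rfl)]
      · rw [act4 (by omega) (by omega)]; omega
    rw [this]
    exact ih (by omega)

lemma rep_fix (j : ℕ) (h1 : 1 ≤ j) (hj : j ≤ n) : act n j 0 = 0 :=
  act0 (by omega) (by omega) (by omega) (by omega)

/-- Every word is rewritten as a word in `K` times a coset representative, without
increasing the length. -/
lemma factor (ω : List (Fin (n + 1))) : ∃ (u : List (Fin (n + 1))) (m : ℕ),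
    (∀ j ∈ u, j ≠ 0) ∧ m ≤ 2 * n + 1 ∧ cs.wordProd ω = cs.wordProd u * dElt n (sN cs) m ∧
      u.length + m ≤ ω.length := by
  induction ω using List.reverseRecOn with
  | nil => exact ⟨[], 0, by simp, by omega, by simp [dElt], by simp⟩
  | append_singleton ω i ih =>
    obtain ⟨u, m, hu, hm, he, hl⟩ := ih
    have hw : cs.wordProd (ω ++ [i]) = cs.wordProd u * (dElt n (sN cs) m * sN cs i) := by
      rw [cs.wordProd_append, he, cs.wordProd_singleton, sN_val, mul_assoc]
    rcases table (rels cs) m i hm (by omega) with ⟨hm', hc⟩ | ⟨m', rfl, hc⟩ | ⟨j, h1, _, hj, hd⟩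
    · refine ⟨u, m + 1, hu, by omega, ?_, by simp; omega⟩
      rw [hw, dElt, hc]
    · refine ⟨u, m', hu, by omega, ?_, by simp; omega⟩
      rw [hw, dElt, hc, mul_assoc, (rels cs).sq, mul_one]
    · refine ⟨u ++ [⟨j, by omega⟩], m, ?_, hm, ?_, by simp; omega⟩
      · intro k hk
        rcases List.mem_append.1 hk with hk | hk
        · exact hu k hk
        · rw [List.mem_singleton.1 hk]
          intro h
          have := congrArg Fin.val h
          simp at this
          omega
      · rw [hw, hd, cs.wordProd_append, cs.wordProd_singleton, sN_of_le cs j hj, mul_assoc]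

lemma eq_dElt (d : V) (hd : ∀ i : Fin (n + 1), i ≠ 0 →
    cs.length d⁻¹ < cs.length (d⁻¹ * cs.simple i)) :
    ∃ m, m ≤ 2 * n + 1 ∧ d = dElt n (sN cs) m ∧ m ≤ cs.length d := by
  obtain ⟨ω, hω, hdω⟩ := cs.exists_isReduced d
  obtain ⟨u, m, hu, hm, he, hl⟩ := factor cs ω
  have hlen : cs.length d = ω.length := by rw [hdω]; exact hω
  rcases u with _ | ⟨j, u⟩
  · refine ⟨m, hm, ?_, ?_⟩
    · rw [hdω, he]; simp
    · rw [hlen]; simpa using hl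
  · exfalso
    have h1 := hd j (hu j (by simp))
    have h2 : d⁻¹ * cs.simple j = (cs.simple j * d)⁻¹ := by simp
    rw [h2, cs.length_inv, cs.length_inv] at h1
    have h3 : cs.simple j * d = cs.wordProd u * dElt n (sN cs) m := by
      rw [hdω, he, cs.wordProd_cons]; simp [mul_assoc]
    rw [h3] at h1
    have h4 := cs.length_mul_le (cs.wordProd u) (dElt n (sN cs) m)
    have h5 := cs.length_wordProd_le u
    have h6 := length_dElt cs m
    simp at hl
    omega

/-- The key lemma: conjugation by minimal double coset representatives increases indices. -/
lemma key (d : V) (hd : ∀ i : Fin (n + 1), i ≠ 0 →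
    cs.length d⁻¹ < cs.length (d⁻¹ * cs.simple i)) (i j : Fin (n + 1)) (hj : j ≠ 0)
    (hi : cs.length d < cs.length (d * cs.simple i))
    (h : cs.simple j = d * cs.simple i * d⁻¹) : i ≤ j := by
  obtain ⟨m, hm, rfl, hlen⟩ := eq_dElt cs d hd
  have h' : cs.simple j * dElt n (sN cs) m = dElt n (sN cs) m * cs.simple i := by
    rw [h]; simp
  have hj1 : 1 ≤ (j : ℕ) := Nat.one_le_iff_ne_zero.2 (fun h => hj (Fin.ext h))
  rcases table (rels cs) m i hm (by omega) with ⟨hm', hc⟩ | ⟨m', rfl, hc⟩ | ⟨k, h1, h2, hk, hd'⟩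
  · exfalso
    have hr := congrFun (congrArg (rep cs) h') ((m + 1 : ℕ) : ℤ)
    rw [map_mul, map_mul] at hr
    have e0 : (rep cs (dElt n (sN cs) m) * rep cs (cs.simple i)) ((m + 1 : ℕ) : ℤ) = 0 := by
      rw [← map_mul, ← sN_val, hc]
      exact rep_dElt cs (m + 1) (by omega)
    rw [e0, rep_simple] at hr
    change act n j (rep cs (dElt n (sN cs) m) ((m + 1 : ℕ) : ℤ)) = 0 at hr
    have hr2 := congrArg (act n j) hr
    rw [act_act n j (by omega), rep_fix j hj1 (by omega), ← rep_dElt cs m hm] at hr2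
    have := rep_inj cs _ _ _ hr2
    omega
  · exfalso
    have h3 := length_dElt cs m'
    have h4 : dElt n (sN cs) (m' + 1) * cs.simple i = dElt n (sN cs) m' := by
      rw [← sN_val, hc, dElt, mul_assoc, (rels cs).sq, mul_one]
    rw [h4] at hi
    omega
  · rw [sN_val, ← h'] at hd'
    have h3 := mul_right_cancel hd'
    rw [sN_of_le cs k hk] at h3
    have := simple_inj cs _ _ h3
    rw [this, Fin.le_def]
    exact h2

end Cox

section Combi

/-- The weight used for triangularity. -/
def wt {n : ℕ} (J : Finset (Fin (n + 1))) : ℕ := ∑ j ∈ J, (n + 1 - (j : ℕ))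

lemma wt_lt {n : ℕ} (J J' : Finset (Fin (n + 1))) (g : Fin (n + 1) → Fin (n + 1))
    (hg : ∀ j ∈ J', g j ∈ J ∧ g j ≤ j) (hinj : Set.InjOn g J') (hne : J' ≠ J) :
    wt J' < wt J := by
  have h1 : wt J' ≤ ∑ j ∈ J', (n + 1 - (g j : ℕ)) :=
    Finset.sum_le_sum fun j hj => by have := Fin.le_def.1 (hg j hj).2; omega
  have h2 : ∑ j ∈ J', (n + 1 - (g j : ℕ)) = ∑ i ∈ J'.image g, (n + 1 - (i : ℕ)) :=
    (Finset.sum_image (f := fun i : Fin (n + 1) => n + 1 - (i : ℕ)) hinj).symm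
  have hsub : J'.image g ⊆ J := by
    intro i hi
    obtain ⟨j, hj, rfl⟩ := Finset.mem_image.1 hi
    exact (hg j hj).1
  have h3 : ∑ i ∈ J'.image g, (n + 1 - (i : ℕ)) ≤ wt J :=
    Finset.sum_le_sum_of_subset hsub
  by_contra hcon
  have heq : wt J' = ∑ j ∈ J', (n + 1 - (g j : ℕ)) := by omega
  have hfix : ∀ j ∈ J', g j = j := by
    intro j hj
    have := (Finset.sum_eq_sum_iff_of_le (fun j hj => by
      have := Fin.le_def.1 (hg j hj).2; omega)).1 heq j hj
    apply Fin.ext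
    omega
  have hsub' : J' ⊆ J := fun j hj => by rw [← hfix j hj]; exact (hg j hj).1
  have hss : J' ⊂ J := Finset.ssubset_iff_subset_ne.2 ⟨hsub', hne⟩
  obtain ⟨i, hi, hi'⟩ := Finset.exists_of_ssubset hss
  have : wt J' < wt J :=
    Finset.sum_lt_sum_of_subset hsub' hi hi' (by omega) (fun _ _ _ => Nat.zero_le _)
  omega

end Combi

end ResB

set_option synthInstance.maxHeartbeats 1000000 in
set_option maxHeartbeats 1000000 in
/-- In type `Bₙ₊₁`, the restriction morphism from `Σ(Wₙ₊₁)` to the descent algebra of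
the standard parabolic subgroup of type `Bₙ` (obtained by removing the simple
reflection at the end of the diagram away from the bond labelled 4, i.e. the index
`0` in the convention of `CoxeterMatrix.Bₙ`) is surjective. -/
theorem resK_typeB_surjective {n : ℕ}
    (cs : CoxeterSystem (CoxeterMatrix.Bₙ (n + 1)) W)
    (A : Subalgebra ℚ (MonoidAlgebra ℚ W)) (hA : IsDescentAlgebra cs A)
    (R : MonoidAlgebra ℚ W →ₗ[ℚ] MonoidAlgebra ℚ W)
    (hR : IsResK cs (Finset.univ.erase (0 : Fin (n + 1))) R) :
    ∀ y ∈ Submodule.span ℚ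
        (parDescentBasis cs (Finset.univ.erase (0 : Fin (n + 1))) ''
          {I : Finset (Fin (n + 1)) | I ⊆ Finset.univ.erase 0}),
      ∃ x ∈ A, R x = y := by
  classical
  set K : Finset (Fin (n + 1)) := Finset.univ.erase 0 with hK
  have hmemK : ∀ i : Fin (n + 1), i ∈ K ↔ i ≠ 0 := by intro i; simp [hK]
  let Im : Submodule ℚ (MonoidAlgebra ℚ W) :=
    (Submodule.span ℚ (Set.range (descentBasis cs))).map R
  suffices hmain : ∀ N : ℕ, ∀ J : Finset (Fin (n + 1)), J ⊆ K → ResB.wt J ≤ N →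
      parDescentBasis cs K J ∈ Im by
    intro y hy
    have hle : Submodule.span ℚ (parDescentBasis cs K '' {I | I ⊆ K}) ≤ Im := by
      rw [Submodule.span_le]
      rintro _ ⟨J, hJ, rfl⟩
      exact hmain _ J hJ le_rfl
    obtain ⟨x, hx, hxy⟩ := hle hy
    refine ⟨x, ?_, hxy⟩
    have : x ∈ (A : Set (MonoidAlgebra ℚ W)) := by rw [hA]; exact hx
    exact this
  intro N
  induction N using Nat.strong_induction_on with
  | _ N ih =>
  intro J hJ hN
  let P : W → Finset (Fin (n + 1)) := fun d =>
    K.filter (fun j => ∃ i ∈ J, cs.simple j = d * cs.simple i * d⁻¹)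
  have hRJ : R (descentBasis cs J) ∈ Im := ⟨_, Submodule.subset_span ⟨J, rfl⟩, rfl⟩
  have hlt : ∀ d, memXKI cs K J d → P d ≠ J → parDescentBasis cs K (P d) ∈ Im := by
    intro d hd hne
    have hex : ∀ j : Fin (n + 1), ∃ i : Fin (n + 1), j ∈ P d →
        i ∈ J ∧ cs.simple j = d * cs.simple i * d⁻¹ := by
      intro j
      by_cases hj : j ∈ P d
      · obtain ⟨i, hi, h⟩ := (Finset.mem_filter.1 hj).2
        exact ⟨i, fun _ => ⟨hi, h⟩⟩
      · exact ⟨0, fun h => absurd h hj⟩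
    choose g hg using hex
    have hw : ResB.wt (P d) < ResB.wt J := by
      refine ResB.wt_lt J (P d) g ?_ ?_ hne
      · intro j hj
        refine ⟨(hg j hj).1, ?_⟩
        exact ResB.key cs d (fun i hi => hd.1 i ((hmemK i).2 hi)) (g j) j
          ((hmemK j).1 (Finset.mem_filter.1 hj).1) (hd.2 _ (hg j hj).1) (hg j hj).2
      · intro a ha b hb hab
        apply ResB.simple_inj cs
        rw [(hg a ha).2, (hg b hb).2, hab]
    exact ih (ResB.wt (P d)) (by omega) (P d) (Finset.filter_subset _ _) le_rfl
  have hsum : R (descentBasis cs J) =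
      ∑ d : W, if memXKI cs K J d then parDescentBasis cs K (P d) else 0 := by
    convert hR J
  have hsplit : R (descentBasis cs J) =
      ((Finset.univ.filter (fun d : W => memXKI cs K J d ∧ P d = J)).card : ℚ) •
        parDescentBasis cs K J +
      ∑ d : W, if memXKI cs K J d ∧ P d ≠ J then parDescentBasis cs K (P d) else 0 := by
    have hc : ((Finset.univ.filter (fun d : W => memXKI cs K J d ∧ P d = J)).card : ℚ) •
        parDescentBasis cs K J =
        ∑ d : W, if memXKI cs K J d ∧ P d = J then parDescentBasis cs K J else 0 := by
      rw [← Finset.sum_filter, Finset.sum_const, Nat.cast_smul_eq_nsmul]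
    rw [hsum, hc, ← Finset.sum_add_distrib]
    refine Finset.sum_congr rfl fun d _ => ?_
    by_cases h1 : memXKI cs K J d <;> by_cases h2 : P d = J <;> simp [h1, h2]
  have hrest : (∑ d : W, if memXKI cs K J d ∧ P d ≠ J then parDescentBasis cs K (P d) else 0)
      ∈ Im := by
    refine Submodule.sum_mem _ fun d _ => ?_
    split_ifs with h
    · exact hlt d h.1 h.2
    · exact Submodule.zero_mem _
  have hone : (1 : W) ∈ Finset.univ.filter (fun d : W => memXKI cs K J d ∧ P d = J) := by
    refine Finset.mem_filter.2 ⟨Finset.mem_univ _, ⟨?_, ?_⟩, ?_⟩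
    · intro i _; simp
    · intro i _; simp
    · ext j
      simp only [P, Finset.mem_filter, one_mul, inv_one, mul_one]
      constructor
      · rintro ⟨_, i, hi, h⟩
        rw [ResB.simple_inj cs j i h]; exact hi
      · intro hj
        exact ⟨hJ hj, j, hj, rfl⟩
  have hcne : ((Finset.univ.filter (fun d : W => memXKI cs K J d ∧ P d = J)).card : ℚ) ≠ 0 := by
    rw [Nat.cast_ne_zero]
    exact Finset.card_ne_zero_of_mem hone
  rw [← Submodule.smul_mem_iff _ hcne]
  rw [hsplit] at hRJ
  exact (Submodule.add_mem_iff_left _ hrest).1 hRJ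
end

section
/- Let (W,S) be a finite Coxeter system and K ⊆ S a self-opposed subset, meaning wKw⁻¹ ⊆ S implies wKw⁻¹ = K for all w ∈ W. Let W(K) = {w ∈ X_{KK} : wKw⁻¹ = K} with Coxeter generating set S(K) = {w_{K∪{s}}w_K : s ∈ S∖K}, and for K ⊆ I ⊆ S set I(K) = {w_{K∪{s}}w_K : s ∈ I∖K}. Then the linear map ψ_K : Σ(W) → Σ(W(K)) defined by ψ_K(x_I) = x^{(K)}_{I(K)} if K ⊆ I and ψ_K(x_I) = 0 otherwise, is a surjective homomorphism of unital algebras. -/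
open MonoidAlgebra

variable {B W : Type*} [DecidableEq B] [Fintype B] [Group W] [Fintype W] [DecidableEq W]

/-- `K ⊆ S` is self-opposed: whenever `wKw⁻¹` consists of simple reflections, it
equals `K`. -/
def IsSelfOpposed {M : CoxeterMatrix B} (cs : CoxeterSystem M W) (K : Finset B) : Prop :=
  ∀ w : W, ((fun x => w * x * w⁻¹) '' (cs.simple '' (K : Set B)) ⊆ Set.range cs.simple) →
    (fun x => w * x * w⁻¹) '' (cs.simple '' (K : Set B)) = cs.simple '' (K : Set B)

/-- `d ∈ X_{KK}` and `dKd⁻¹ = K`, i.e. `d ∈ W(K)`, the complement of `W_K` in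
`N_W(W_K)` (a Coxeter group with simple system `S(K) = {w_{K∪{s}}w_K : s ∈ S∖K}`). -/
def memWK {M : CoxeterMatrix B} (cs : CoxeterSystem M W) (K : Finset B) (d : W) : Prop :=
  (∀ i ∈ K, cs.length d⁻¹ < cs.length (d⁻¹ * cs.simple i)) ∧
  (∀ i ∈ K, cs.length d < cs.length (d * cs.simple i)) ∧
  (fun x => d * x * d⁻¹) '' (cs.simple '' (K : Set B)) = cs.simple '' (K : Set B)

open scoped Classical in
/-- `x^{(K)}_{I(K)}`: the basis element of the descent algebra `Σ(W(K))` of the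
Coxeter group `(W(K), S(K))` indexed by `I(K) = {w_{K∪{s}}w_K : s ∈ I∖K}` for
`K ⊆ I ⊆ S`, viewed inside `ℚW`.  (An element `w ∈ W(K)` satisfies
`ℓ_{(K)}(w·w_{K,s}) > ℓ_{(K)}(w)` if and only if `ℓ(ws) > ℓ(w)`, so the descent
condition can be expressed via the ambient length function.) -/
noncomputable def wkDescentBasis {M : CoxeterMatrix B} (cs : CoxeterSystem M W)
    (K I : Finset B) : MonoidAlgebra ℚ W :=
  ∑ w : W, if memWK cs K w ∧ ∀ i ∈ I \ K, cs.length w < cs.length (w * cs.simple i)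
    then MonoidAlgebra.single w (1 : ℚ) else 0

open scoped Classical in
/-- The defining formula for `ψ_K : Σ(W) → Σ(W(K))` on the basis:
`ψ_K(x_I) = x^{(K)}_{I(K)}` if `K ⊆ I`, and `ψ_K(x_I) = 0` otherwise. -/
def IsPsiK {M : CoxeterMatrix B} (cs : CoxeterSystem M W) (K : Finset B)
    (P : MonoidAlgebra ℚ W →ₗ[ℚ] MonoidAlgebra ℚ W) : Prop :=
  ∀ I : Finset B, P (descentBasis cs I) =
    if K ⊆ I then wkDescentBasis cs K I else 0

set_option linter.unusedSectionVars false

namespace PsiK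

section Cocycle

variable {M : CoxeterMatrix B} (cs : CoxeterSystem M W)

/-- The action of a simple reflection on `W × ℤ/2`. -/
def refl (s : W) : Function.End (W × ZMod 2) :=
  fun p => (s * p.1 * s⁻¹, p.2 + if p.1 = s then 1 else 0)


theorem end_mul {α : Type*} (f g : Function.End α) (x : α) : (f * g) x = f (g x) := rfl

theorem end_one {α : Type*} (x : α) : (1 : Function.End α) x = x := rfl

theorem refl_mul_pow (a b : W) (ha : a * a = 1) (hb : b * b = 1) (n : ℕ) (t : W) (e : ZMod 2) :
    ((refl a * refl b) ^ n) (t, e) = ((a * b) ^ n * t * ((a * b) ^ n)⁻¹,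
      e + ∑ k ∈ Finset.range (2 * n), if t = b * (a * b) ^ k then 1 else 0) := by
  have ha' : a⁻¹ = a := inv_eq_of_mul_eq_one_left ha
  have hb' : b⁻¹ = b := inv_eq_of_mul_eq_one_left hb
  have hbc : ∀ n : ℕ, ((a * b) ^ n)⁻¹ * b = b * (a * b) ^ n := by
    intro n
    induction n with
    | zero => simp
    | succ n ih =>
      rw [pow_succ (a * b) n, mul_inv_rev, mul_assoc, ih, mul_inv_rev, ha', hb', ← pow_succ,
        pow_succ']
      simp only [← mul_assoc]
  induction n with
  | zero => simp [end_one]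
  | succ n ih =>
    rw [pow_succ', end_mul, ih, end_mul]
    unfold refl
    simp only
    have e1 : (a * b) ^ n * t * ((a * b) ^ n)⁻¹ = b ↔ t = b * (a * b) ^ (2 * n) := by
      rw [two_mul, pow_add, ← mul_assoc, ← hbc]
      generalize (a * b) ^ n = c
      constructor
      · intro h; rw [← h]; group
      · intro h; rw [h]; group
    have e2 : b * ((a * b) ^ n * t * ((a * b) ^ n)⁻¹) * b⁻¹ = a ↔
        t = b * (a * b) ^ (2 * n + 1) := by
      have : b * (a * b) ^ (2 * n + 1) = ((a * b) ^ n)⁻¹ * (b * (a * b)) * (a * b) ^ n := by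
        rw [← mul_assoc, hbc, two_mul, mul_assoc, mul_assoc]
        congr 1
        rw [← pow_succ', ← pow_add]
        congr 1
      rw [this]
      constructor
      · intro h
        have hx : (a * b) ^ n * t * ((a * b) ^ n)⁻¹ = b * (a * b) := by
          generalize (a * b) ^ n * t * ((a * b) ^ n)⁻¹ = y at h
          rw [← h, inv_mul_cancel_right, ← mul_assoc, hb, one_mul]
        rw [← hx]
        generalize (a * b) ^ n = c
        group
      · intro h; rw [h, hb']
        simp only [← mul_assoc]
        rw [mul_inv_cancel_right]
        rw [mul_assoc b, mul_inv_cancel, mul_one, hb, one_mul, mul_assoc, hb, mul_one]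
    rw [Prod.mk.injEq]
    constructor
    · rw [pow_succ', mul_inv_rev, mul_inv_rev]; simp only [mul_assoc]
    · rw [show 2 * (n + 1) = 2 * n + 1 + 1 by ring, Finset.sum_range_succ,
        Finset.sum_range_succ]
      simp only [e1, e2]
      ring

theorem liftable : M.IsLiftable (fun i => refl (cs.simple i)) := by
  intro i j
  funext ⟨t, e⟩
  rw [refl_mul_pow _ _ (cs.simple_mul_simple_self i) (cs.simple_mul_simple_self j)]
  have hc := cs.simple_mul_simple_pow i j
  rw [hc, two_mul, Finset.sum_range_add]
  simp only [pow_add, hc, one_mul, mul_one, inv_one]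
  rw [CharTwo.add_self_eq_zero, add_zero]
  rfl

/-- The reflection representation on `W × ℤ/2`. -/
noncomputable def rep : W →* Function.End (W × ZMod 2) :=
  cs.lift ⟨fun i => refl (cs.simple i), liftable cs⟩

/-- The cocycle. -/
noncomputable def coc (w t : W) : ZMod 2 := (rep cs w (t, 0)).2

theorem rep_simple (i : B) : rep cs (cs.simple i) = refl (cs.simple i) :=
  cs.lift_apply_simple (liftable cs) i

theorem rep_apply (w t : W) (e : ZMod 2) : rep cs w (t, e) = (w * t * w⁻¹, e + coc cs w t) := by
  unfold coc
  induction w using cs.simple_induction_left generalizing t e with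
  | one => simp [end_one]
  | mul_simple_left w i ih =>
    rw [map_mul, end_mul, end_mul, ih t e, ih t 0,
      rep_simple]
    simp only [refl, Prod.mk.injEq]
    constructor
    · group
    · ring

theorem coc_mul (x y t : W) : coc cs (x * y) t = coc cs y t + coc cs x (y * t * y⁻¹) := by
  have h := rep_apply cs (x * y) t 0
  rw [map_mul, end_mul, rep_apply, rep_apply] at h
  have := congrArg Prod.snd h
  simpa using this.symm

theorem coc_one (t : W) : coc cs 1 t = 0 := by simp [coc, end_one]

theorem coc_simple (i : B) (t : W) : coc cs (cs.simple i) t = if t = cs.simple i then 1 else 0 := by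
  simp [coc, rep_simple, refl]

theorem exchange (ω : List B) (t : W) (h : coc cs (cs.wordProd ω) t ≠ 0) :
    ∃ ω' : List B, ω'.Sublist ω ∧ ω'.length + 1 = ω.length ∧
      cs.wordProd ω * t = cs.wordProd ω' := by
  induction ω with
  | nil => simp [coc_one] at h
  | cons i ω ih =>
    by_cases h0 : coc cs (cs.wordProd ω) t = 0
    · rw [cs.wordProd_cons, coc_mul, h0, coc_simple, zero_add] at h
      refine ⟨ω, List.sublist_cons_self _ _, rfl, ?_⟩
      have : cs.wordProd ω * t * (cs.wordProd ω)⁻¹ = cs.simple i := by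
        by_contra hne; simp [hne] at h
      rw [cs.wordProd_cons, ← this]
      have h2 : cs.wordProd ω * t = cs.simple i * cs.wordProd ω := by rw [← this]; group
      rw [this, mul_assoc, h2, cs.simple_mul_simple_cancel_left]
    · obtain ⟨ω', h1, h2, h3⟩ := ih h0
      refine ⟨i :: ω', h1.cons_cons i, by simp [h2], ?_⟩
      rw [cs.wordProd_cons, cs.wordProd_cons, mul_assoc, h3]

theorem lt_of_coc_ne (w t : W) (h : coc cs w t ≠ 0) : cs.length (w * t) < cs.length w := by
  obtain ⟨ω, hω, rfl⟩ := cs.exists_isReduced w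
  obtain ⟨ω', -, h2, h3⟩ := exchange cs ω t h
  rw [h3, hω.eq]
  have := cs.length_wordProd_le ω'
  omega

theorem coc_self {t : W} (ht : cs.IsReflection t) : coc cs t t = 1 := by
  obtain ⟨w, i, rfl⟩ := ht
  have h1 := coc_mul cs w w⁻¹ (w * cs.simple i * w⁻¹)
  rw [mul_inv_cancel, coc_one] at h1
  have e : w⁻¹ * (w * cs.simple i * w⁻¹) * w⁻¹⁻¹ = cs.simple i := by group
  rw [e] at h1
  rw [coc_mul, e, coc_mul, coc_simple, if_pos rfl]
  simp only [cs.simple_mul_simple_self, cs.inv_simple, one_mul]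
  linear_combination -h1

theorem coc_zero_iff {t : W} (ht : cs.IsReflection t) (w : W) :
    coc cs w t = 0 ↔ cs.length w < cs.length (w * t) := by
  constructor
  · intro h
    have := lt_of_coc_ne cs (w * t) t (by
      rw [coc_mul, coc_self cs ht, mul_inv_cancel_right, h]; decide)
    rwa [mul_assoc, ht.mul_self, mul_one] at this
  · intro h
    by_contra h'
    exact absurd (lt_of_coc_ne cs w t h') (by omega)

theorem coc_simple_zero_iff (w : W) (i : B) :
    coc cs w (cs.simple i) = 0 ↔ cs.length w < cs.length (w * cs.simple i) :=
  coc_zero_iff cs (cs.isReflection_simple i) w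

end Cocycle

section Parabolic

variable {M : CoxeterMatrix B} (cs : CoxeterSystem M W)

/-- Standard parabolic subgroup, via words. -/
def par (I : Finset B) : Subgroup W where
  carrier := {w | ∃ ω : List B, (∀ i ∈ ω, i ∈ I) ∧ cs.wordProd ω = w}
  one_mem' := ⟨[], by simp, by simp⟩
  mul_mem' := by
    rintro _ _ ⟨ω, h, rfl⟩ ⟨ω', h', rfl⟩
    refine ⟨ω ++ ω', ?_, cs.wordProd_append _ _⟩
    intro i hi
    rcases List.mem_append.1 hi with hi | hi
    exacts [h i hi, h' i hi]
  inv_mem' := by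
    rintro _ ⟨ω, h, rfl⟩
    exact ⟨ω.reverse, by simpa using h, cs.wordProd_reverse _⟩

theorem simple_mem_par {I : Finset B} {i : B} (hi : i ∈ I) : cs.simple i ∈ par cs I :=
  ⟨[i], by simpa using hi, by simp⟩

theorem exists_reduced {I : Finset B} (ω : List B) (h : ∀ i ∈ ω, i ∈ I) :
    ∃ ω' : List B, (∀ i ∈ ω', i ∈ I) ∧ cs.IsReduced ω' ∧ cs.wordProd ω' = cs.wordProd ω := by
  induction ω using List.reverseRecOn with
  | nil => exact ⟨[], by simp, by simp [CoxeterSystem.IsReduced], rfl⟩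
  | append_singleton ω i ih =>
    obtain ⟨ω', h1, h2, h3⟩ := ih (fun j hj => h j (by simp [hj]))
    have hi : i ∈ I := h i (by simp)
    rw [cs.wordProd_append, cs.wordProd_singleton, ← h3]
    by_cases hc : coc cs (cs.wordProd ω') (cs.simple i) = 0
    · refine ⟨ω' ++ [i], ?_, ?_, by simp [cs.wordProd_append]⟩
      · intro j hj
        rcases List.mem_append.1 hj with hj | hj
        · exact h1 j hj
        · simp at hj; exact hj ▸ hi
      · rw [coc_simple_zero_iff] at hc
        have h2' := h2.eq
        have := cs.length_mul_simple (cs.wordProd ω') i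
        unfold CoxeterSystem.IsReduced
        rw [cs.wordProd_append, cs.wordProd_singleton, List.length_append, List.length_singleton]
        omega
    · obtain ⟨ω'', h4, h5, h6⟩ := exchange cs ω' _ hc
      refine ⟨ω'', fun j hj => h1 j (h4.subset hj), ?_, h6.symm⟩
      have := lt_of_coc_ne cs _ _ hc
      have h2' := h2.eq
      have h7 := cs.length_mul_simple (cs.wordProd ω') i
      unfold CoxeterSystem.IsReduced
      rw [← h6]
      omega

theorem par_descent {I : Finset B} {a : W} (ha : a ∈ par cs I) (h1 : a ≠ 1) :
    ∃ i ∈ I, ∃ b ∈ par cs I, a = b * cs.simple i ∧ cs.length a = cs.length b + 1 := by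
  obtain ⟨ω, h, rfl⟩ := ha
  obtain ⟨ω', h2, h3, h4⟩ := exists_reduced cs ω h
  rw [← h4] at h1 ⊢
  rcases List.eq_nil_or_concat ω' with rfl | ⟨l, i, rfl⟩
  · simp at h1
  · simp only [List.concat_eq_append] at *
    refine ⟨i, h2 i (by simp), cs.wordProd l, ⟨l, fun j hj => h2 j (by simp [hj]), rfl⟩,
      by simp [cs.wordProd_append], ?_⟩
    have := h3.eq
    have h5 := cs.length_wordProd_le l
    rw [List.length_append, List.length_singleton] at this
    have h6 := cs.length_mul_simple (cs.wordProd l) i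
    rw [cs.wordProd_append, cs.wordProd_singleton] at this ⊢
    omega

/-- Membership in `X_I`. -/
def X (I : Finset B) (w : W) : Prop := ∀ i ∈ I, cs.length w < cs.length (w * cs.simple i)

theorem X_iff (I : Finset B) (w : W) : X cs I w ↔ ∀ i ∈ I, coc cs w (cs.simple i) = 0 := by
  simp only [X, coc_simple_zero_iff]

theorem length_add_of_min {I : Finset B} {u : W}
    (hu : ∀ b ∈ par cs I, cs.length u ≤ cs.length (u * b)) (a : W) (ha : a ∈ par cs I) :
    cs.length (u * a) = cs.length u + cs.length a := by
  generalize hn : cs.length a = n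
  induction n generalizing a with
  | zero => rw [cs.length_eq_zero_iff] at hn; simp [hn]
  | succ n ih =>
    obtain ⟨i, hi, b, hb, rfl, hl⟩ := par_descent cs ha (by rintro rfl; simp at hn)
    have hb' : cs.length b = n := by omega
    have h1 := ih b hb hb'
    have h2 : coc cs (u * b) (cs.simple i) = 0 := by
      have r : cs.IsReflection (b * cs.simple i * b⁻¹) := ⟨b, i, rfl⟩
      have hbi : coc cs b (cs.simple i) = 0 := by rw [coc_simple_zero_iff]; omega
      rw [coc_mul, hbi, zero_add, coc_zero_iff cs r]
      exact lt_of_le_of_ne (hu _ ((par cs I).mul_mem ((par cs I).mul_mem hb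
        (simple_mem_par cs hi)) ((par cs I).inv_mem hb))) (r.length_mul_left_ne u).symm
    rw [coc_simple_zero_iff] at h2
    have := cs.length_mul_simple (u * b) i
    rw [← mul_assoc]
    omega

theorem exists_min (I : Finset B) (w : W) : ∃ u : W, u⁻¹ * w ∈ par cs I ∧
    ∀ b ∈ par cs I, cs.length u ≤ cs.length (u * b) := by
  classical
  have hex : ∃ n, ∃ u : W, u⁻¹ * w ∈ par cs I ∧ cs.length u = n := ⟨_, w, by simp [(par cs I).one_mem], rfl⟩
  obtain ⟨u, hu, hn⟩ := Nat.find_spec hex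
  refine ⟨u, hu, fun b hb => ?_⟩
  rw [hn]
  apply Nat.find_min' hex
  refine ⟨u * b, ?_, rfl⟩
  rw [mul_inv_rev, mul_assoc]
  exact (par cs I).mul_mem ((par cs I).inv_mem hb) hu

theorem X_of_min {I : Finset B} {u : W}
    (hu : ∀ b ∈ par cs I, cs.length u ≤ cs.length (u * b)) : X cs I u := fun i hi =>
  lt_of_le_of_ne (hu _ (simple_mem_par cs hi)) (cs.length_mul_simple_ne u i).symm

theorem eq_of_X {I : Finset B} {u u0 : W}
    (hu : ∀ b ∈ par cs I, cs.length u0 ≤ cs.length (u0 * b)) (hX : X cs I u)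
    (hm : u0⁻¹ * u ∈ par cs I) : u = u0 := by
  by_contra hne
  obtain ⟨i, hi, b, hb, hab, hl⟩ := par_descent cs hm (by
    intro h; exact hne (inv_mul_eq_one.1 h).symm)
  have h1 := length_add_of_min cs hu _ hm
  have h2 := length_add_of_min cs hu b hb
  have h3 := hX i hi
  have h4 : u * cs.simple i = u0 * b := by
    have : u = u0 * (b * cs.simple i) := by rw [← hab]; group
    rw [this, ← mul_assoc, cs.simple_mul_simple_cancel_right]
  rw [mul_inv_cancel_left] at h1
  rw [h4] at h3
  omega

theorem min_of_X {I : Finset B} {u : W} (hX : X cs I u) :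
    ∀ b ∈ par cs I, cs.length u ≤ cs.length (u * b) := by
  obtain ⟨u0, h1, h2⟩ := exists_min cs I u
  rw [eq_of_X cs h2 hX h1]
  exact h2

theorem length_add {I : Finset B} {u a : W} (hX : X cs I u) (ha : a ∈ par cs I) :
    cs.length (u * a) = cs.length u + cs.length a :=
  length_add_of_min cs (min_of_X cs hX) a ha

theorem coc_X_par {I : Finset B} {u a : W} (hX : X cs I u) (ha : a ∈ par cs I) {i : B}
    (hi : i ∈ I) : coc cs u (a * cs.simple i * a⁻¹) = 0 := by
  have r : cs.IsReflection (a * cs.simple i * a⁻¹) := ⟨a, i, rfl⟩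
  rw [coc_zero_iff cs r]
  exact lt_of_le_of_ne (min_of_X cs hX _ ((par cs I).mul_mem ((par cs I).mul_mem ha
        (simple_mem_par cs hi)) ((par cs I).inv_mem ha))) (r.length_mul_left_ne u).symm

/-- Minimal coset representative. -/
noncomputable def mcr (I : Finset B) (w : W) : W := (exists_min cs I w).choose

theorem mcr_mem (I : Finset B) (w : W) : (mcr cs I w)⁻¹ * w ∈ par cs I :=
  (exists_min cs I w).choose_spec.1

theorem mcr_X (I : Finset B) (w : W) : X cs I (mcr cs I w) :=
  X_of_min cs (exists_min cs I w).choose_spec.2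

theorem mcr_eq {I : Finset B} {u a : W} (hX : X cs I u) (ha : a ∈ par cs I) :
    mcr cs I (u * a) = u := by
  refine (eq_of_X cs (exists_min cs I (u * a)).choose_spec.2 hX ?_).symm
  have := mcr_mem cs I (u * a)
  have h2 := (par cs I).mul_mem this ((par cs I).inv_mem ha)
  rw [← mul_assoc, mul_inv_cancel_right] at h2
  exact h2

theorem deodhar {d : W} {i j : B} (h1 : cs.length d⁻¹ < cs.length (d⁻¹ * cs.simple i))
    (h2 : cs.length d < cs.length (d * cs.simple j))
    (h3 : ¬ cs.length (d * cs.simple j)⁻¹ < cs.length ((d * cs.simple j)⁻¹ * cs.simple i)) :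
    d * cs.simple j * d⁻¹ = cs.simple i := by
  have e1 : cs.length (d⁻¹ * cs.simple i) = cs.length (cs.simple i * d) := by
    rw [← cs.length_inv, mul_inv_rev, inv_inv, cs.inv_simple]
  have e2 : cs.length ((d * cs.simple j)⁻¹ * cs.simple i) =
      cs.length (cs.simple i * d * cs.simple j) := by
    rw [← cs.length_inv, mul_inv_rev, inv_inv, cs.inv_simple, mul_assoc]
  rw [e1, cs.length_inv] at h1
  rw [e2, cs.length_inv] at h3
  have h4 := cs.length_mul_simple d j
  have h5 := cs.length_simple_mul (d * cs.simple j) i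
  rw [← mul_assoc] at h5
  have h6 : ¬ coc cs (cs.simple i * d) (cs.simple j) = 0 := by
    rw [coc_simple_zero_iff]; omega
  rw [coc_mul, (coc_simple_zero_iff cs d j).2 h2, coc_simple] at h6
  by_contra hne
  simp [hne] at h6

end Parabolic

section Complement

variable {M : CoxeterMatrix B} (cs : CoxeterSystem M W) {K : Finset B}

theorem memWK_of {a : W} (hX : X cs K a)
    (him : (fun x => a * x * a⁻¹) '' (cs.simple '' (K : Set B)) = cs.simple '' (K : Set B)) :
    memWK cs K a := by
  refine ⟨?_, hX, him⟩
  change X cs K a⁻¹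
  rw [X_iff] at hX ⊢
  intro i hi
  have : cs.simple i ∈ cs.simple '' (K : Set B) := ⟨i, hi, rfl⟩
  rw [← him] at this
  obtain ⟨_, ⟨k, hk, rfl⟩, h⟩ := this
  simp only at h
  have h2 := coc_mul cs a a⁻¹ (cs.simple i)
  rw [mul_inv_cancel, coc_one] at h2
  have h3 : a⁻¹ * cs.simple i * a⁻¹⁻¹ = cs.simple k := by rw [← h]; group
  rw [h3, hX k hk, add_zero] at h2
  exact h2.symm

theorem memWK_X {a : W} (h : memWK cs K a) : X cs K a := h.2.1

theorem memWK_conj {a : W} (h : memWK cs K a) {k : B} (hk : k ∈ K) :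
    ∃ k' ∈ K, a * cs.simple k * a⁻¹ = cs.simple k' := by
  have : a * cs.simple k * a⁻¹ ∈ cs.simple '' (K : Set B) := by
    rw [← h.2.2]; exact ⟨_, ⟨k, hk, rfl⟩, rfl⟩
  obtain ⟨k', hk', h⟩ := this
  exact ⟨k', hk', h.symm⟩

theorem memWK_mul {a b : W} (ha : memWK cs K a) (hb : memWK cs K b) : memWK cs K (a * b) := by
  apply memWK_of
  · rw [X_iff]
    intro k hk
    obtain ⟨k', hk', h⟩ := memWK_conj cs hb hk
    rw [coc_mul, h, (X_iff cs K a).1 (memWK_X cs ha) k' hk',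
      (X_iff cs K b).1 (memWK_X cs hb) k hk, add_zero]
  · have : (fun x => a * b * x * (a * b)⁻¹) = (fun x => a * x * a⁻¹) ∘ (fun x => b * x * b⁻¹) := by
      funext x; simp only [Function.comp_apply]; group
    rw [this, Set.image_comp, hb.2.2, ha.2.2]

theorem memWK_inv {a : W} (ha : memWK cs K a) : memWK cs K a⁻¹ := by
  refine ⟨by rw [inv_inv]; exact ha.2.1, ha.1, ?_⟩
  conv_lhs => rw [← ha.2.2]
  rw [← Set.image_comp]
  convert Set.image_id _
  funext x; simp only [Function.comp_apply, id]; group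

theorem memWK_of_mul (hK : IsSelfOpposed cs K) {I : Finset B} (hKI : K ⊆ I) {u a : W}
    (hu : X cs I u) (ha : a ∈ par cs I) (h : memWK cs K (u * a)) : memWK cs K a := by
  apply memWK_of
  · rw [X_iff]
    intro k hk
    have := (X_iff cs K _).1 (memWK_X cs h) k hk
    rwa [coc_mul, coc_X_par cs hu ha (hKI hk), add_zero] at this
  · apply hK
    rintro _ ⟨_, ⟨k, hk, rfl⟩, rfl⟩
    simp only
    obtain ⟨k', hk', h'⟩ := memWK_conj cs h hk
    have hl := length_add cs hu (a := a * cs.simple k * a⁻¹) ((par cs I).mul_mem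
      ((par cs I).mul_mem ha (simple_mem_par cs (hKI hk))) ((par cs I).inv_mem ha))
    have e : u * (a * cs.simple k * a⁻¹) = cs.simple k' * u := by rw [← h']; group
    have h2 := cs.length_simple_mul u k'
    rw [e] at hl
    have r : cs.IsReflection (a * cs.simple k * a⁻¹) := ⟨a, k, rfl⟩
    obtain ⟨m, hm⟩ := r.odd_length
    have : cs.length (a * cs.simple k * a⁻¹) = 1 := by omega
    rw [cs.length_eq_one_iff] at this
    obtain ⟨i, hi⟩ := this
    exact ⟨i, hi.symm⟩

open scoped Classical in
/-- `d⁻¹ I d ∩ J`. -/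
noncomputable def L (I J : Finset B) (d : W) : Finset B :=
  J.filter (fun j => ∃ i ∈ I, d * cs.simple j * d⁻¹ = cs.simple i)

/-- From the left side to the right side of the structure-constant bijection. -/
theorem forward (hK : IsSelfOpposed cs K) {I J : Finset B} (hKI : K ⊆ I) {u v : W}
    (hu : memWK cs K u) (huX : X cs I u) (hv : memWK cs K v) (hvX : X cs J v) :
    ∃ d a : W, a ∈ par cs I ∧ v = a * d ∧ memWK cs K d ∧ X cs J d ∧ X cs I d⁻¹ ∧
      d = (mcr cs I v⁻¹)⁻¹ ∧
      memWK cs K (u * v) ∧ X cs (L cs I J d) (u * v) := by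
  have ha0 := mcr_mem cs I v⁻¹
  have hdX := mcr_X cs I v⁻¹
  obtain ⟨d, hd⟩ : ∃ d, d = (mcr cs I v⁻¹)⁻¹ := ⟨_, rfl⟩
  have hd' : mcr cs I v⁻¹ = d⁻¹ := by rw [hd, inv_inv]
  rw [hd'] at ha0 hdX
  have ha := (par cs I).inv_mem ha0
  obtain ⟨a, rfl⟩ : ∃ a, v = a * d := ⟨v * d⁻¹, by group⟩
  have e : (d⁻¹⁻¹ * (a * d)⁻¹)⁻¹ = a := by group
  rw [e] at ha
  have hai := (par cs I).inv_mem ha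
  have hvi : memWK cs K (d⁻¹ * a⁻¹) := by rw [← mul_inv_rev]; exact memWK_inv cs hv
  have hCa : memWK cs K a := by
    have := memWK_inv cs (memWK_of_mul cs hK hKI hdX hai hvi)
    rwa [inv_inv] at this
  have hCd : memWK cs K d := by
    have := memWK_mul cs (memWK_inv cs hCa) hv
    rwa [inv_mul_cancel_left] at this
  refine ⟨d, a, ha, rfl, hCd, ?_, hdX, hd, memWK_mul cs hu hv, ?_⟩
  · intro j hj
    have h1 := hvX j hj
    have h2 := length_add cs hdX hai
    rw [← mul_inv_rev, cs.length_inv, cs.length_inv, cs.length_inv] at h2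
    have h3 := cs.length_mul_le a (d * cs.simple j)
    rw [← mul_assoc] at h3
    omega
  · rw [X_iff]
    intro j hj
    simp only [L, Finset.mem_filter] at hj
    obtain ⟨hj, i, hi, hij⟩ := hj
    have e2 : a * d * cs.simple j * (a * d)⁻¹ = a * cs.simple i * a⁻¹ := by rw [← hij]; group
    rw [coc_mul, (X_iff cs J _).1 hvX j hj, e2, coc_X_par cs huX ha hi, add_zero]

theorem backward (hK : IsSelfOpposed cs K) {I J : Finset B} (hKI : K ⊆ I) {d w : W}
    (hd : memWK cs K d) (hdJ : X cs J d) (hdI : X cs I d⁻¹) (hw : memWK cs K w)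
    (hwL : X cs (L cs I J d) w) :
    ∃ u a : W, a ∈ par cs I ∧ w = u * (a * d) ∧ u = mcr cs I (w * d⁻¹) ∧ memWK cs K u ∧
      X cs I u ∧ memWK cs K (a * d) ∧ X cs J (a * d) := by
  have ha := mcr_mem cs I (w * d⁻¹)
  have huX := mcr_X cs I (w * d⁻¹)
  obtain ⟨u, hu⟩ : ∃ u, u = mcr cs I (w * d⁻¹) := ⟨_, rfl⟩
  rw [← hu] at ha huX
  obtain ⟨a, rfl⟩ : ∃ a, w = u * (a * d) := ⟨u⁻¹ * w * d⁻¹, by group⟩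
  have e : u⁻¹ * (u * (a * d) * d⁻¹) = a := by group
  rw [e] at ha
  have hua : memWK cs K (u * a) := by
    have := memWK_mul cs hw (memWK_inv cs hd)
    rwa [← mul_assoc, mul_inv_cancel_right] at this
  have hCa := memWK_of_mul cs hK hKI huX ha hua
  have hCu : memWK cs K u := by
    have := memWK_mul cs hua (memWK_inv cs hCa)
    rwa [mul_inv_cancel_right] at this
  refine ⟨u, a, ha, rfl, hu, hCu, huX, memWK_mul cs hCa hd, ?_⟩
  intro j hj
  by_cases hjL : ∃ i ∈ I, d * cs.simple j * d⁻¹ = cs.simple i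
  · have h1 := (X_iff cs _ _).1 hwL j (by simp only [L, Finset.mem_filter]; exact ⟨hj, hjL⟩)
    obtain ⟨i, hi, hij⟩ := hjL
    have e2 : a * d * cs.simple j * (a * d)⁻¹ = a * cs.simple i * a⁻¹ := by rw [← hij]; group
    rw [coc_mul, e2, coc_X_par cs huX ha hi, add_zero, coc_simple_zero_iff] at h1
    exact h1
  · have h1 : X cs I (d * cs.simple j)⁻¹ := by
      intro i hi
      by_contra hcon
      exact hjL ⟨i, hi, deodhar cs (hdI i hi) (hdJ j hj) hcon⟩
    have h2 := length_add cs h1 ((par cs I).inv_mem ha)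
    rw [← mul_inv_rev, cs.length_inv, cs.length_inv, cs.length_inv, ← mul_assoc] at h2
    have h3 := hdJ j hj
    have h4 := cs.length_mul_le a d
    omega

end Complement

section Algebra

variable {M : CoxeterMatrix B} (cs : CoxeterSystem M W) {K : Finset B}

open scoped Classical in
theorem wk_eq {I : Finset B} (hKI : K ⊆ I) : wkDescentBasis cs K I =
    ∑ w ∈ Finset.univ.filter (fun w : W => memWK cs K w ∧ X cs I w),
      MonoidAlgebra.single w (1 : ℚ) := by
  unfold wkDescentBasis
  rw [Finset.sum_filter]
  apply Finset.sum_congr rfl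
  intro w _
  congr 1
  apply propext
  refine and_congr_right fun hw => ⟨fun h i hi => ?_, fun h i hi => h i (Finset.mem_sdiff.1 hi).1⟩
  by_cases hik : i ∈ K
  · exact hw.2.1 i hik
  · exact h i (Finset.mem_sdiff.2 ⟨hi, hik⟩)

theorem K_sub_L {I J : Finset B} (hKI : K ⊆ I) (hKJ : K ⊆ J) {d : W} (hd : memWK cs K d) :
    K ⊆ L cs I J d := by
  intro k hk
  simp only [L, Finset.mem_filter]
  obtain ⟨k', hk', h⟩ := memWK_conj cs hd hk
  exact ⟨hKJ hk, k', hKI hk', h⟩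

open scoped Classical in
theorem wk_mul (hK : IsSelfOpposed cs K) {I J : Finset B} (hKI : K ⊆ I) (hKJ : K ⊆ J) :
    wkDescentBasis cs K I * wkDescentBasis cs K J =
    ∑ d ∈ Finset.univ.filter (fun d : W => memWK cs K d ∧ X cs J d ∧ X cs I d⁻¹),
      wkDescentBasis cs K (L cs I J d) := by
  rw [wk_eq cs hKI, wk_eq cs hKJ, Finset.sum_mul_sum]
  have hR : ∑ d ∈ Finset.univ.filter (fun d : W => memWK cs K d ∧ X cs J d ∧ X cs I d⁻¹),
      wkDescentBasis cs K (L cs I J d) =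
      ∑ d ∈ Finset.univ.filter (fun d : W => memWK cs K d ∧ X cs J d ∧ X cs I d⁻¹),
      ∑ w ∈ Finset.univ.filter (fun w : W => memWK cs K w ∧ X cs (L cs I J d) w),
      MonoidAlgebra.single w (1 : ℚ) := by
    apply Finset.sum_congr rfl
    intro d hd
    exact wk_eq cs (K_sub_L cs hKI hKJ (Finset.mem_filter.1 hd).2.1)
  rw [hR, Finset.sum_sigma', Finset.sum_sigma']
  simp only [MonoidAlgebra.single_mul_single, mul_one]
  refine Finset.sum_bij' (fun p _ => ⟨(mcr cs I p.2⁻¹)⁻¹, p.1 * p.2⟩)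
    (fun q _ => ⟨mcr cs I (q.2 * q.1⁻¹), (mcr cs I (q.2 * q.1⁻¹))⁻¹ * q.2⟩) ?_ ?_ ?_ ?_ ?_
  · rintro ⟨u, v⟩ h
    simp only [Finset.mem_sigma, Finset.mem_filter, Finset.mem_univ, true_and] at h ⊢
    obtain ⟨⟨h1, h2⟩, h3, h4⟩ := h
    obtain ⟨d, a, -, -, h5, h6, h7, h8, h9, h10⟩ := forward cs hK hKI h1 h2 h3 h4
    rw [← h8]
    exact ⟨⟨h5, h6, h7⟩, h9, h10⟩
  · rintro ⟨d, w⟩ h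
    simp only [Finset.mem_sigma, Finset.mem_filter, Finset.mem_univ, true_and] at h ⊢
    obtain ⟨⟨h1, h2, h3⟩, h4, h5⟩ := h
    obtain ⟨u, a, -, h6, h7, h8, h9, h10, h11⟩ := backward cs hK hKI h1 h2 h3 h4 h5
    rw [← h7]
    have : u⁻¹ * w = a * d := by rw [h6]; group
    rw [this]
    exact ⟨⟨h8, h9⟩, h10, h11⟩
  · rintro ⟨u, v⟩ h
    simp only [Finset.mem_sigma, Finset.mem_filter, Finset.mem_univ, true_and] at h ⊢
    obtain ⟨⟨h1, h2⟩, h3, h4⟩ := h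
    obtain ⟨d, a, ha, hv, h5, h6, h7, h8, h9, h10⟩ := forward cs hK hKI h1 h2 h3 h4
    rw [← h8]
    have : u * v * d⁻¹ = u * a := by rw [hv]; group
    rw [this, mcr_eq cs h2 ha]
    simp
  · rintro ⟨d, w⟩ h
    simp only [Finset.mem_sigma, Finset.mem_filter, Finset.mem_univ, true_and] at h ⊢
    obtain ⟨⟨h1, h2, h3⟩, h4, h5⟩ := h
    obtain ⟨u, a, ha, h6, h7, h8, h9, h10, h11⟩ := backward cs hK hKI h1 h2 h3 h4 h5
    rw [← h7]
    have : (u⁻¹ * w)⁻¹ = d⁻¹ * a⁻¹ := by rw [h6]; group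
    rw [this, mcr_eq cs h3 ((par cs I).inv_mem ha)]
    simp
  · rintro ⟨u, v⟩ h
    rfl

theorem memWK_empty (w : W) : memWK cs ∅ w := by
  refine ⟨by simp, by simp, by simp⟩

theorem selfOpposed_empty : IsSelfOpposed cs ∅ := by
  intro w _
  simp

theorem descentBasis_eq (I : Finset B) : descentBasis cs I = wkDescentBasis cs ∅ I := by
  unfold descentBasis wkDescentBasis
  apply Finset.sum_congr rfl
  intro w _
  simp only [memWK_empty, true_and, Finset.sdiff_empty]

open scoped Classical in
theorem solomon (I J : Finset B) : descentBasis cs I * descentBasis cs J =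
    ∑ d ∈ Finset.univ.filter (fun d : W => X cs J d ∧ X cs I d⁻¹),
      descentBasis cs (L cs I J d) := by
  simp only [descentBasis_eq]
  rw [wk_mul cs (selfOpposed_empty cs) (Finset.empty_subset _) (Finset.empty_subset _)]
  simp only [memWK_empty, true_and]

theorem memWK_of_sub_L (hK : IsSelfOpposed cs K) {I J : Finset B} {d : W} (hd : X cs J d)
    (h : K ⊆ L cs I J d) : memWK cs K d ∧ cs.simple '' (K : Set B) ⊆ cs.simple '' (I : Set B) := by
  have h1 : (fun x => d * x * d⁻¹) '' (cs.simple '' (K : Set B)) ⊆ cs.simple '' (I : Set B) := by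
    rintro _ ⟨_, ⟨k, hk, rfl⟩, rfl⟩
    have := h hk
    simp only [L, Finset.mem_filter] at this
    obtain ⟨_, i, hi, e⟩ := this
    exact ⟨i, hi, e.symm⟩
  have h2 := hK d (h1.trans (Set.image_subset_range _ _))
  refine ⟨memWK_of cs (fun k hk => hd k ?_) h2, h2 ▸ h1⟩
  have := h hk
  simp only [L, Finset.mem_filter] at this
  exact this.1

theorem descentBasis_union {I : Finset B}
    (h : cs.simple '' (K : Set B) ⊆ cs.simple '' (I : Set B)) :
    descentBasis cs (I ∪ K) = descentBasis cs I := by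
  unfold descentBasis
  apply Finset.sum_congr rfl
  intro w _
  congr 1
  apply propext
  refine ⟨fun h i hi => h i (Finset.mem_union_left _ hi), fun h' i hi => ?_⟩
  rcases Finset.mem_union.1 hi with hi | hi
  · exact h' i hi
  · obtain ⟨j, hj, e⟩ := h ⟨i, hi, rfl⟩
    rw [← e]; exact h' j hj

theorem psi_mul (hK : IsSelfOpposed cs K)
    (P : MonoidAlgebra ℚ W →ₗ[ℚ] MonoidAlgebra ℚ W) (hP : IsPsiK cs K P) (I J : Finset B) :
    P (descentBasis cs I * descentBasis cs J) = P (descentBasis cs I) * P (descentBasis cs J) := by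
  classical
  have key : ∀ I : Finset B, K ⊆ I → P (descentBasis cs I * descentBasis cs J) =
      P (descentBasis cs I) * P (descentBasis cs J) := by
    intro I hKI
    rw [solomon, map_sum]
    simp only [hP _]
    by_cases hKJ : K ⊆ J
    · rw [if_pos hKI, if_pos hKJ, wk_mul cs hK hKI hKJ, ← Finset.sum_filter, Finset.filter_filter]
      apply Finset.sum_congr _ (fun _ _ => rfl)
      ext d
      simp only [Finset.mem_filter, Finset.mem_univ, true_and]
      constructor
      · rintro ⟨⟨h1, h2⟩, h3⟩
        exact ⟨(memWK_of_sub_L cs hK h1 h3).1, h1, h2⟩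
      · rintro ⟨h1, h2, h3⟩
        exact ⟨⟨h2, h3⟩, K_sub_L cs hKI hKJ h1⟩
    · rw [if_neg hKJ, mul_zero]
      apply Finset.sum_eq_zero
      intro d _
      rw [if_neg]
      exact fun h => hKJ (h.trans (Finset.filter_subset _ _))
  by_cases hI : cs.simple '' (K : Set B) ⊆ cs.simple '' (I : Set B)
  · rw [← descentBasis_union cs hI]
    exact key _ Finset.subset_union_right
  · have hKI : ¬ K ⊆ I := fun h => hI (Set.image_mono (by exact_mod_cast h))
    rw [hP I, if_neg hKI, zero_mul, solomon, map_sum]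
    apply Finset.sum_eq_zero
    intro d hd
    rw [hP, if_neg]
    exact fun h => hI (memWK_of_sub_L cs hK (Finset.mem_filter.1 hd).2.1 h).2

theorem eq_one_of_X {w : W} (h : X cs Finset.univ w) : w = 1 := by
  by_contra hne
  obtain ⟨i, hi⟩ := cs.exists_rightDescent_of_ne_one hne
  have := h i (Finset.mem_univ i)
  unfold CoxeterSystem.IsRightDescent at hi
  omega

theorem X_one (I : Finset B) : X cs I 1 := by
  intro i _
  simp

theorem wk_univ : wkDescentBasis cs K Finset.univ = 1 := by
  classical
  rw [wk_eq cs (Finset.subset_univ _), MonoidAlgebra.one_def]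
  rw [Finset.sum_eq_single_of_mem (1 : W)]
  · simp only [Finset.mem_filter, Finset.mem_univ, true_and]
    exact ⟨memWK_of cs (X_one cs K) (by simp), X_one cs _⟩
  · intro w hw hne
    exact absurd (eq_one_of_X cs (Finset.mem_filter.1 hw).2.2) hne

end Algebra

end PsiK

set_option synthInstance.maxHeartbeats 1000000 in
set_option maxHeartbeats 1000000 in
/-- If `K` is a self-opposed subset of `S`, then the map
`ψ_K : Σ(W) → Σ(W(K))`, `x_I ↦ x^{(K)}_{I(K)}` for `K ⊆ I` and `x_I ↦ 0` otherwise,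
is a surjective homomorphism of unital algebras onto the descent algebra of the
Coxeter group `(W(K), S(K))`. -/
theorem psiK_surjective_algHom {M : CoxeterMatrix B}
    (cs : CoxeterSystem M W) (A : Subalgebra ℚ (MonoidAlgebra ℚ W))
    (hA : IsDescentAlgebra cs A) (K : Finset B) (hK : IsSelfOpposed cs K)
    (P : MonoidAlgebra ℚ W →ₗ[ℚ] MonoidAlgebra ℚ W) (hP : IsPsiK cs K P) :
    P 1 = 1 ∧ (∀ x ∈ A, ∀ y ∈ A, P (x * y) = P x * P y) ∧
    (∀ y ∈ Submodule.span ℚ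
        (wkDescentBasis cs K '' {I : Finset B | K ⊆ I}),
      ∃ x ∈ A, P x = y) := by
  have hmem : ∀ x, x ∈ A ↔ x ∈ Submodule.span ℚ (Set.range (descentBasis cs)) := by
    intro x
    have := Set.ext_iff.1 hA x
    simpa using this
  refine ⟨?_, ?_, ?_⟩
  · have h := hP Finset.univ
    rw [if_pos (Finset.subset_univ K), PsiK.wk_univ, PsiK.descentBasis_eq, PsiK.wk_univ] at h
    exact h
  · intro x hx y hy
    rw [hmem] at hx hy
    induction hx using Submodule.span_induction with
    | mem x hx =>
      obtain ⟨I, rfl⟩ := hx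
      induction hy using Submodule.span_induction with
      | mem y hy =>
        obtain ⟨J, rfl⟩ := hy
        exact PsiK.psi_mul cs hK P hP I J
      | zero => simp
      | add y z _ _ h1 h2 => simp only [mul_add, map_add, h1, h2]
      | smul c y _ h => simp only [mul_smul_comm, map_smul, h]
    | zero => simp
    | add u z _ _ h1 h2 => simp only [add_mul, map_add, h1, h2]
    | smul c u _ h => simp only [smul_mul_assoc, map_smul, h]
  · intro y hy
    induction hy using Submodule.span_induction with
    | mem y hy =>
      obtain ⟨I, hI, rfl⟩ := hy
      refine ⟨descentBasis cs I, (hmem _).2 (Submodule.subset_span ⟨I, rfl⟩), ?_⟩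
      rw [hP I, if_pos (show K ⊆ I from hI)]
    | zero => exact ⟨0, A.zero_mem, map_zero P⟩
    | add u v _ _ h1 h2 =>
      obtain ⟨a, ha, rfl⟩ := h1
      obtain ⟨b, hb, rfl⟩ := h2
      exact ⟨a + b, A.add_mem ha hb, map_add P a b⟩
    | smul c u _ h =>
      obtain ⟨a, ha, rfl⟩ := h
      exact ⟨c • a, A.smul_mem ha c, map_smul P c a⟩
end
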